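/- Let Γ be a topological space and suppose there exists a continuous injective map e : K → Γ from the Y-graph K into Γ. Then for every n ≥ 2 there exist an injective map f : Fin n → Γ, a transposition τ ∈ Equiv.Perm (Fin n), and a continuous path γ : [0,1] → Conf(Γ,n) with γ(0) = f and γ(1) = f ∘ τ. (This expresses that for any graph containing a Y-subgraph, the first Stiefel–Whitney class of the canonical bundle ξ_{Γ,n} is nonzero for all n ≥ 2.) -/

import Mathlib

/-- The ordered configuration space of `n` points in `X`:
the subspace `{f : Fin n → X | f injective}` of the product `X ^ (Fin n)`. -/
abbrev Conf (X : Type*) [TopologicalSpace X] (n : ℕ) : Type _ :=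
  {f : Fin n → X // Function.Injective f}

/-- The symmetric group `Σ_n = Equiv.Perm (Fin n)` acts on `Conf X n` by `σ • f = f ∘ σ⁻¹`. -/
instance confMulAction (X : Type*) [TopologicalSpace X] (n : ℕ) :
    MulAction (Equiv.Perm (Fin n)) (Conf X n) where
  smul σ f := ⟨f.1 ∘ ⇑σ⁻¹, f.2.comp (Equiv.injective _)⟩
  one_smul _ := Subtype.ext rfl
  mul_smul _ _ _ := Subtype.ext rfl

/-- The unordered configuration space `UConf X n = Conf(X,n)/Σ_n`, with the quotient topology. -/
abbrev UConf (X : Type*) [TopologicalSpace X] (n : ℕ) : Type _ :=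
  Quotient (MulAction.orbitRel (Equiv.Perm (Fin n)) (Conf X n))

/-- The Y-graph: the union in `ℂ` of the three segments from the origin to the
third roots of unity. -/
def Ygraph : Set ℂ :=
  ⋃ k : Fin 3, {z : ℂ | ∃ t : ℝ, t ∈ Set.Icc (0 : ℝ) 1 ∧
    z = (t : ℂ) * Complex.exp (2 * Real.pi * Complex.I * ((k : ℕ) : ℂ) / 3)}

/-- Barycentric-style coordinates on the Y-graph: each coordinate is the distance travelled along
one of the three arms, so that at most one of them is nonzero. -/
def tripod : Set (ℝ × ℝ × ℝ) :=
  {u | (0 ≤ u.1 ∧ u.1 ≤ 1) ∧ (0 ≤ u.2.1 ∧ u.2.1 ≤ 1) ∧ (0 ≤ u.2.2 ∧ u.2.2 ≤ 1) ∧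
    ((u.2.1 = 0 ∧ u.2.2 = 0) ∨ (u.1 = 0 ∧ u.2.2 = 0) ∨ (u.1 = 0 ∧ u.2.1 = 0))}

/-- The linear map to the plane sending the standard basis to the third roots of unity. -/
noncomputable def planar (u : ℝ × ℝ × ℝ) : ℂ :=
  ((u.1 - (u.2.1 + u.2.2) / 2 : ℝ) : ℂ) + ((√3 / 2 * (u.2.1 - u.2.2) : ℝ) : ℂ) * Complex.I

theorem continuous_planar : Continuous planar := by
  unfold planar
  fun_prop

theorem injOn_planar : Set.InjOn planar tripod := by
  rintro ⟨a, b, c⟩ ⟨⟨h1, -⟩, ⟨h2, -⟩, ⟨h3, -⟩, h4⟩ ⟨x, y, z⟩ ⟨⟨k1, -⟩, ⟨k2, -⟩, ⟨k3, -⟩, k4⟩ h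
  have hre := congrArg Complex.re h
  have him := congrArg Complex.im h
  simp only [planar, Complex.add_re, Complex.add_im, Complex.re_ofReal_mul, Complex.im_ofReal_mul,
    Complex.ofReal_re, Complex.ofReal_im, Complex.I_re, Complex.I_im, mul_zero, mul_one, add_zero,
    zero_add] at hre him h1 h2 h3 h4 k1 k2 k3 k4
  have h3pos : (√3 / 2 : ℝ) ≠ 0 := by positivity
  have him' := mul_left_cancel₀ h3pos him
  have : a = x ∧ b = y ∧ c = z := by
    rcases h4 with h4 | h4 | h4 <;> rcases k4 with k4 | k4 | k4 <;>
      obtain ⟨h5, h6⟩ := h4 <;> obtain ⟨k5, k6⟩ := k4 <;>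
      refine ⟨?_, ?_, ?_⟩ <;> linarith
  simp [this]

theorem exp_two_pi_I_div_three :
    Complex.exp (2 * Real.pi * Complex.I / 3) =
      ((-1 / 2 : ℝ) : ℂ) + ((√3 / 2 : ℝ) : ℂ) * Complex.I := by
  have h : (2 * Real.pi * Complex.I / 3 : ℂ) = ((Real.pi - Real.pi / 3 : ℝ) : ℂ) * Complex.I := by
    push_cast
    ring
  rw [h, Complex.exp_mul_I, ← Complex.ofReal_cos, ← Complex.ofReal_sin, Real.cos_pi_sub,
    Real.sin_pi_sub, Real.cos_pi_div_three, Real.sin_pi_div_three, neg_div]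

theorem exp_four_pi_I_div_three :
    Complex.exp (2 * Real.pi * Complex.I * 2 / 3) =
      ((-1 / 2 : ℝ) : ℂ) + ((-(√3 / 2) : ℝ) : ℂ) * Complex.I := by
  have h : (2 * Real.pi * Complex.I * 2 / 3 : ℂ) =
      ((Real.pi / 3 + Real.pi : ℝ) : ℂ) * Complex.I := by
    push_cast
    ring
  rw [h, Complex.exp_mul_I, ← Complex.ofReal_cos, ← Complex.ofReal_sin, Real.cos_add_pi,
    Real.sin_add_pi, Real.cos_pi_div_three, Real.sin_pi_div_three, neg_div]

theorem mapsTo_planar : Set.MapsTo planar tripod Ygraph := by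
  rintro ⟨a, b, c⟩ ⟨h1, h2, h3, h4⟩
  simp only at h1 h2 h3 h4
  simp only [Ygraph, Set.mem_iUnion, Set.mem_ofPred_eq]
  rcases h4 with ⟨rfl, rfl⟩ | ⟨rfl, rfl⟩ | ⟨rfl, rfl⟩
  · exact ⟨0, a, h1, by simp [planar]⟩
  · refine ⟨1, b, h2, ?_⟩
    simp only [Fin.val_one, Nat.cast_one, mul_one, exp_two_pi_I_div_three, planar]
    push_cast
    ring
  · refine ⟨2, c, h3, ?_⟩
    simp only [Fin.val_two, Nat.cast_ofNat, exp_four_pi_I_div_three, planar]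
    push_cast
    ring

/-- The motion, for times in `[0, 3]`, exchanging particles `0` and `1` on the inner half of the
tripod while the other particles rest on the outer half of the first arm. Particle `0` moves from
the second to the first arm, particle `1` from the third to the second, and finally particle `0`
from the first to the third. -/
noncomputable def exchange : ℕ → ℝ → ℝ × ℝ × ℝ
  | 0, s => (max 0 (min (s - 1 / 2) (min (5 / 2 - s) (1 / 2))), max 0 (1 / 2 - s),
      max 0 (s - 5 / 2))
  | 1, s => (0, max 0 (min (1 / 2) (s - 3 / 2)), max 0 (min (1 / 2) (3 / 2 - s)))
  | i + 2, _ => (1 - 1 / ((i : ℝ) + 3), 0, 0)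

theorem continuous_exchange (i : ℕ) : Continuous (exchange i) := by
  match i with
  | 0 => unfold exchange; fun_prop
  | 1 => unfold exchange; fun_prop
  | i + 2 => unfold exchange; fun_prop

theorem exchange_mem_tripod (i : ℕ) {s : ℝ} (h0 : 0 ≤ s) (h3 : s ≤ 3) :
    exchange i s ∈ tripod := by
  match i with
  | 0 =>
    simp only [exchange, tripod, Set.mem_ofPred_eq]
    grind (splits := 30)
  | 1 =>
    have h (x : ℝ) : max 0 (min (1 / 2) x) ≤ 1 :=
      max_le zero_le_one ((min_le_left _ _).trans (by norm_num))
    simp only [exchange, tripod, Set.mem_ofPred_eq]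
    refine ⟨by norm_num, ⟨le_max_left _ _, h _⟩, ⟨le_max_left _ _, h _⟩, ?_⟩
    grind
  | i + 2 =>
    have h : 1 / ((i : ℝ) + 3) ≤ 1 := by
      rw [div_le_one (by positivity)]
      linarith [(Nat.cast_nonneg i : (0 : ℝ) ≤ i)]
    have h' : 0 ≤ 1 / ((i : ℝ) + 3) := by positivity
    simp only [exchange, tripod, Set.mem_ofPred_eq]
    refine ⟨⟨by linarith, by linarith⟩, by norm_num, by norm_num, by norm_num⟩

theorem half_lt_exchange_fst (i : ℕ) (s : ℝ) : 1 / 2 < (exchange (i + 2) s).1 := by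
  have h : 1 / ((i : ℝ) + 3) < 1 / 2 :=
    one_div_lt_one_div_of_lt (by norm_num) (by linarith [(Nat.cast_nonneg i : (0 : ℝ) ≤ i)])
  simp only [exchange]
  linarith

theorem exchange_zero_fst_le (s : ℝ) : (exchange 0 s).1 ≤ 1 / 2 := by
  simp only [exchange]
  grind

theorem exchange_one_fst_le (s : ℝ) : (exchange 1 s).1 ≤ 1 / 2 := by
  norm_num [exchange]

theorem exchange_zero_ne_one (s : ℝ) : exchange 0 s ≠ exchange 1 s := by
  simp only [exchange, ne_eq, Prod.mk.injEq]
  grind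

theorem injective_exchange (s : ℝ) : Function.Injective fun i => exchange i s := by
  intro i j h
  have hfst := congrArg Prod.fst h
  match i, j with
  | 0, 0 => rfl
  | 1, 1 => rfl
  | 0, 1 => exact absurd h (exchange_zero_ne_one s)
  | 1, 0 => exact absurd h.symm (exchange_zero_ne_one s)
  | 0, j + 2 => exact absurd hfst ((exchange_zero_fst_le s).trans_lt (half_lt_exchange_fst j s)).ne
  | 1, j + 2 => exact absurd hfst ((exchange_one_fst_le s).trans_lt (half_lt_exchange_fst j s)).ne
  | i + 2, 0 => exact absurd hfst ((exchange_zero_fst_le s).trans_lt (half_lt_exchange_fst i s)).ne'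
  | i + 2, 1 => exact absurd hfst ((exchange_one_fst_le s).trans_lt (half_lt_exchange_fst i s)).ne'
  | i + 2, j + 2 => simpa [exchange] using h

theorem exchange_zero_three : exchange 0 3 = exchange 1 0 := by
  norm_num [exchange]

theorem exchange_one_three : exchange 1 3 = exchange 0 0 := by
  norm_num [exchange]

/-- If a space contains a topologically embedded Y-graph, then for every `n ≥ 2` some
transposition is realized as the monodromy of a loop in the unordered configuration space. -/
theorem stmt13 (Γ : Type*) [TopologicalSpace Γ] (e : ↥Ygraph → Γ)
    (he : Continuous e) (hinj : Function.Injective e) (n : ℕ) (hn : 2 ≤ n) :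
    ∃ (f : Conf Γ n) (τ : Equiv.Perm (Fin n)), τ.IsSwap ∧
      ∃ γ : unitInterval → Conf Γ n, Continuous γ ∧ γ 0 = f ∧ (γ 1).1 = f.1 ∘ ⇑τ := by
  have hmem (i : ℕ) (t : unitInterval) : exchange i (3 * t) ∈ tripod :=
    exchange_mem_tripod i (by linarith [t.2.1]) (by linarith [t.2.2])
  let γ : unitInterval → Conf Γ n := fun t =>
    ⟨fun i => e ⟨planar (exchange i (3 * t)), mapsTo_planar (hmem i t)⟩, fun i j hij =>
      Fin.ext (injective_exchange _
        (injOn_planar (hmem i t) (hmem j t) (Subtype.ext_iff.mp (hinj hij))))⟩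
  have hγ : Continuous γ := by
    refine Continuous.subtype_mk (continuous_pi fun i => he.comp ?_) _
    refine Continuous.subtype_mk (continuous_planar.comp ((continuous_exchange i).comp ?_)) _
    fun_prop
  have hne : (⟨0, by omega⟩ : Fin n) ≠ ⟨1, by omega⟩ := by simp
  refine ⟨γ 0, Equiv.swap ⟨0, by omega⟩ ⟨1, by omega⟩, ⟨_, _, hne, rfl⟩, γ, hγ, rfl, ?_⟩
  funext i
  have key : exchange i 3 =
      exchange (Equiv.swap (⟨0, by omega⟩ : Fin n) ⟨1, by omega⟩ i : Fin n) 0 := by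
    match i with
    | ⟨0, _⟩ => rw [Equiv.swap_apply_left]; exact exchange_zero_three
    | ⟨1, _⟩ => rw [Equiv.swap_apply_right]; exact exchange_one_three
    | ⟨i + 2, _⟩ => rw [Equiv.swap_apply_of_ne_of_ne (by simp) (by simp)]; rfl
  refine congrArg e (Subtype.ext (congrArg planar ?_))
  simpa using key
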